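/- arXiv:2601.02974 — 2 statements merged into one kernel-verified Lean document; each statement's English description precedes it below -/
import Mathlib

section
/- Let V, c_1, c_2 be positive reals and c_0 ≥ 0 with c_2 ≥ c_0. Let 𝐎 ⊂ ℝ² be a compact convex set of area V whose intersection with {x_1 ≤ c_1} equals {(x_1, x_2) : 0 ≤ x_1 ≤ c_1, 0 ≤ x_2 ≤ ((c_2 − c_0)/c_1)·x_1 + c_0}. Let (b_1, b_2) be the barycenter of 𝐎. Then b_2 ≤ (−c_0³c_1² + 4c_0²c_1V − 4c_0V² + 4c_2V²)/(6 c_1 c_2 V). -/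
open MeasureTheory

/-- A concave-type profile `w` on `(a, ∞)` starting at height `c` and having the same integral as
the linear profile decreasing from `c` to `0` on `(a, a + τ]` has at most the first moment of
that linear profile. -/
lemma setIntegral_first_moment_le_of_star {w : ℝ → ℝ} {a c τ : ℝ} (hτ : 0 < τ)
    (hw0 : ∀ x, 0 ≤ w x) (hw : Integrable w) (hxw : Integrable fun x => x * w x)
    (hstar : ∀ x, a < x → 0 < w x → ∀ v, a < v → v ≤ x →
      (x - v) * c + (v - a) * w x ≤ (x - a) * w v)
    (hA : ∫ x in Set.Ioi a, w x = c * τ / 2) :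
    ∫ x in Set.Ioi a, (x - a) * w x ≤ c * τ ^ 2 / 6 := by
  set f : ℝ → ℝ := fun x => c * (1 - (x - a) / τ) with hf
  set q : ℝ → ℝ := (Set.Ioc a (a + τ)).indicator f with hq
  have hfc : Continuous f := by fun_prop
  have hsub : Set.Ioi a ∩ Set.Ioc a (a + τ) = Set.Ioc a (a + τ) :=
    Set.inter_eq_right.2 fun x hx => hx.1
  have hqi : Integrable q :=
    (integrable_indicator_iff measurableSet_Ioc).2 hfc.integrableOn_Ioc
  have hxq_eq : (fun x => x * q x) = (Set.Ioc a (a + τ)).indicator (fun x => x * f x) := by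
    ext x
    by_cases hx : x ∈ Set.Ioc a (a + τ) <;> simp [hq, hx]
  have hxqi : Integrable fun x => x * q x := by
    rw [hxq_eq]
    exact (integrable_indicator_iff measurableSet_Ioc).2
      (by fun_prop : Continuous fun x => x * f x).integrableOn_Ioc
  have hqA : ∫ x in Set.Ioi a, q x = c * τ / 2 := by
    rw [hq, setIntegral_indicator measurableSet_Ioc, hsub,
      ← intervalIntegral.integral_of_le (by linarith)]
    have hderiv : ∀ x ∈ Set.uIcc a (a + τ),
        HasDerivAt (fun x => c * ((x - a) - (x - a) ^ 2 / (2 * τ))) (f x) x := by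
      intro x _
      have h := (((hasDerivAt_id x).sub_const a).sub
        ((((hasDerivAt_id x).sub_const a).pow 2).div_const (2 * τ))).const_mul c
      refine h.congr_deriv ?_
      simp only [hf, id]
      field_simp
      norm_num
      ring
    rw [intervalIntegral.integral_eq_sub_of_hasDerivAt hderiv (hfc.intervalIntegrable _ _)]
    field_simp; ring
  have hqM : ∫ x in Set.Ioi a, (x - a) * q x = c * τ ^ 2 / 6 := by
    have : (fun x => (x - a) * q x) =
        (Set.Ioc a (a + τ)).indicator (fun x => (x - a) * f x) := by
      ext x
      by_cases hx : x ∈ Set.Ioc a (a + τ) <;> simp [hq, hx]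
    rw [this, setIntegral_indicator measurableSet_Ioc, hsub,
      ← intervalIntegral.integral_of_le (by linarith)]
    have hderiv : ∀ x ∈ Set.uIcc a (a + τ),
        HasDerivAt (fun x => c * ((x - a) ^ 2 / 2 - (x - a) ^ 3 / (3 * τ)))
          ((x - a) * f x) x := by
      intro x _
      have h := (((((hasDerivAt_id x).sub_const a).pow 2).div_const 2).sub
        ((((hasDerivAt_id x).sub_const a).pow 3).div_const (3 * τ))).const_mul c
      refine h.congr_deriv ?_
      simp only [hf, id]
      field_simp
      norm_num
      ring
    rw [intervalIntegral.integral_eq_sub_of_hasDerivAt hderiv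
      ((by fun_prop : Continuous fun x => (x - a) * f x).intervalIntegrable _ _)]
    field_simp; ring
  have hd : ∫ x in Set.Ioi a, (w x - q x) = 0 := by
    rw [integral_sub hw.integrableOn hqi.integrableOn, hA, hqA, sub_self]
  have hdi : ∀ b, Integrable fun x => (x - b) * (w x - q x) := by
    intro b
    refine ((hxw.sub hxqi).sub ((hw.sub hqi).const_mul b)).congr (.of_forall fun x => ?_)
    simp only [Pi.sub_apply]; ring
  have hshift : ∀ b, ∫ x in Set.Ioi a, (x - a) * (w x - q x) =
      ∫ x in Set.Ioi a, (x - b) * (w x - q x) := by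
    intro b
    have h : ∀ x, (x - a) * (w x - q x) = (x - b) * (w x - q x) + (b - a) * (w x - q x) :=
      fun x => by ring
    have hdc : Integrable fun x => (b - a) * (w x - q x) := (hw.sub hqi).const_mul (b - a)
    simp_rw [h]
    rw [integral_add (hdi b).integrableOn hdc.integrableOn,
      integral_const_mul, hd, mul_zero, add_zero]
  have key : ∫ x in Set.Ioi a, (x - a) * (w x - q x) ≤ 0 := by
    by_cases hS : ∃ v ∈ Set.Ioc a (a + τ), w v < f v
    · set S : Set ℝ := {v | v ∈ Set.Ioc a (a + τ) ∧ w v < f v} with hSdef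
      have hSb : BddBelow S := ⟨a, fun v hv => hv.1.1.le⟩
      have hSn : S.Nonempty := hS
      rw [hshift (sInf S)]
      refine setIntegral_nonpos measurableSet_Ioi fun x hx => ?_
      rcases lt_trichotomy x (sInf S) with hlt | heq | hgt
      · have hxt : x ≤ a + τ := by
          obtain ⟨v, hv⟩ := hSn
          exact (hlt.le.trans (csInf_le hSb hv)).trans hv.1.2
        have hxS : x ∉ S := notMem_of_lt_csInf hlt hSb
        have hxI : x ∈ Set.Ioc a (a + τ) := ⟨hx, hxt⟩
        have hle : f x ≤ w x := by
          by_contra! h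
          exact hxS ⟨hxI, h⟩
        have hqx : q x = f x := Set.indicator_of_mem hxI f
        rw [hqx]
        exact mul_nonpos_of_nonpos_of_nonneg (by linarith) (by linarith)
      · simp [heq]
      · obtain ⟨v, hv, hvx⟩ := exists_lt_of_csInf_lt hSn hgt
        refine mul_nonpos_of_nonneg_of_nonpos (by linarith) (sub_nonpos.2 ?_)
        have hc : 0 ≤ c := by
          have h2 : 0 < f v := (hw0 v).trans_lt hv.2
          have h3 : 0 ≤ 1 - (v - a) / τ := by
            rw [sub_nonneg, div_le_one hτ]; linarith [hv.1.2]
          by_contra! h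
          exact absurd h2 (not_lt.2 (mul_nonpos_of_nonpos_of_nonneg h.le h3))
        have hfq : ∀ y, 0 ≤ q y := fun y => Set.indicator_nonneg (fun z hz =>
          mul_nonneg hc (by rw [sub_nonneg, div_le_one hτ]; linarith [hz.2])) y
        rcases (hw0 x).eq_or_lt with h0 | hpos
        · rw [← h0]; exact hfq x
        have hva : a < v := hv.1.1
        have h1 := hstar x hx hpos v hva hvx.le
        have h2 := hv.2
        have hxa : 0 < x - a := sub_pos.2 hx
        have hlt : w x < f x := by
          have h3 : (x - a) * w v < (x - a) * f v := mul_lt_mul_of_pos_left h2 hxa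
          have h4 : (x - a) * f v = (x - v) * c + (v - a) * f x := by
            simp only [hf]; field_simp; ring
          have h5 : (v - a) * w x < (v - a) * f x := by linarith
          exact lt_of_mul_lt_mul_left h5 (by linarith)
        by_cases hxt : x ≤ a + τ
        · have hqx : q x = f x := Set.indicator_of_mem (Set.mem_Ioc.2 ⟨hx, hxt⟩) f
          rw [hqx]; exact hlt.le
        · exfalso
          have : f x ≤ 0 := mul_nonpos_of_nonneg_of_nonpos hc
            (by rw [sub_nonpos, one_le_div hτ]; linarith)
          linarith
    · push Not at hS
      have hle : ∀ x, 0 ≤ w x - q x := by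
        intro x
        by_cases hx : x ∈ Set.Ioc a (a + τ)
        · simpa [hq, hx] using hS x hx
        · simpa [hq, hx] using hw0 x
      have hae := (integral_eq_zero_iff_of_nonneg hle (hw.sub hqi).integrableOn).1 hd
      refine (integral_eq_zero_of_ae ?_).le
      filter_upwards [hae] with x hx
      simp only [Pi.zero_apply] at hx ⊢
      rw [hx, mul_zero]
  have hsplit : ∀ x, (x - a) * (w x - q x) = (x - a) * w x - (x - a) * q x := fun x => by ring
  simp_rw [hsplit] at key
  have hi : ∀ {r : ℝ → ℝ}, Integrable r → Integrable (fun x => x * r x) →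
      Integrable fun x => (x - a) * r x := by
    intro r h1 h2
    refine (h2.sub (h1.const_mul a)).congr (.of_forall fun x => ?_)
    simp only [Pi.sub_apply]; ring
  rw [integral_sub (hi hw hxw).integrableOn (hi hqi hxqi).integrableOn, hqM] at key
  linarith

/-- Vertical slices of a compact convex planar set are empty or compact intervals. -/
lemma slice_eq_empty_or_Icc {O : Set (ℝ × ℝ)} (hcpt : IsCompact O) (hconv : Convex ℝ O) (x : ℝ) :
    Prod.mk x ⁻¹' O = ∅ ∨ ∃ l h, l ≤ h ∧ Prod.mk x ⁻¹' O = Set.Icc l h := by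
  rcases (Prod.mk x ⁻¹' O).eq_empty_or_nonempty with he | hne
  · exact .inl he
  right
  have hc : IsCompact (Prod.mk x ⁻¹' O) :=
    (hcpt.image continuous_snd).of_isClosed_subset
      (hcpt.isClosed.preimage (Continuous.prodMk_right x)) fun y hy => ⟨(x, y), hy, rfl⟩
  have hv : Convex ℝ (Prod.mk x ⁻¹' O) := by
    intro y hy z hz s t hs ht hst
    have := hconv hy hz hs ht hst
    simpa [Prod.smul_mk, ← add_mul, hst] using this
  have hI := eq_Icc_of_connected_compact ⟨hne, hv.isPreconnected⟩ hc
  refine ⟨_, _, ?_, hI⟩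
  rw [hI] at hne
  exact Set.nonempty_Icc.1 hne

lemma integral_indicator_slice {O : Set (ℝ × ℝ)} {x l h : ℝ} (f : ℝ × ℝ → ℝ) (hlh : l ≤ h)
    (hs : Prod.mk x ⁻¹' O = Set.Icc l h) :
    ∫ y, O.indicator f (x, y) = ∫ y in l..h, f (x, y) := by
  have : (fun y => O.indicator f (x, y)) = (Set.Icc l h).indicator (fun y => f (x, y)) := by
    rw [← hs]; rfl
  rw [this, integral_indicator measurableSet_Icc, integral_Icc_eq_integral_Ioc,
    intervalIntegral.integral_of_le hlh]

lemma integral_indicator_slice_empty {O : Set (ℝ × ℝ)} {x : ℝ} (f : ℝ × ℝ → ℝ)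
    (hs : Prod.mk x ⁻¹' O = ∅) : ∫ y, O.indicator f (x, y) = 0 := by
  have : (fun y => O.indicator f (x, y)) = (∅ : Set ℝ).indicator (fun y => f (x, y)) := by
    rw [← hs]; rfl
  simp [this]

lemma setIntegral_Iic_eq_of_zero_of_neg {F G : ℝ → ℝ} {c : ℝ} (hc : 0 ≤ c)
    (h0 : ∀ x < 0, F x = 0) (h1 : ∀ x, 0 ≤ x → x ≤ c → F x = G x) :
    ∫ x in Set.Iic c, F x = ∫ x in (0 : ℝ)..c, G x := by
  have : Set.EqOn F ((Set.Icc 0 c).indicator G) (Set.Iic c) := by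
    intro x hx
    by_cases hx0 : 0 ≤ x
    · rw [Set.indicator_of_mem (Set.mem_Icc.2 ⟨hx0, hx⟩), h1 x hx0 hx]
    · rw [Set.indicator_of_notMem (fun h => hx0 h.1), h0 x (not_le.1 hx0)]
  rw [setIntegral_congr_fun measurableSet_Iic this, setIntegral_indicator measurableSet_Icc,
    Set.inter_eq_right.2 fun x hx => hx.2, integral_Icc_eq_integral_Ioc,
    intervalIntegral.integral_of_le hc]

/-- The part of a convex set beyond the trapezoid stays between the two lines extending the
horizontal sides. -/
lemma snd_mem_of_trapezoid_slice {c0 c1 c2 : ℝ} (hc1 : 0 < c1) (hc0 : 0 ≤ c0)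
    {O : Set (ℝ × ℝ)} (hconv : Convex ℝ O)
    (hslice : O ∩ {p : ℝ × ℝ | p.1 ≤ c1} =
      {p : ℝ × ℝ | 0 ≤ p.1 ∧ p.1 ≤ c1 ∧ 0 ≤ p.2 ∧ p.2 ≤ (c2 - c0) / c1 * p.1 + c0})
    {x y : ℝ} (hx : c1 < x) (hy : (x, y) ∈ O) : 0 ≤ y ∧ y ≤ (c2 - c0) / c1 * x + c0 := by
  have hx0 : 0 < x := hc1.trans hx
  have hmem : ∀ z, 0 ≤ z → z ≤ c0 → (0, z) ∈ O := fun z h1 h2 =>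
    (hslice.ge ⟨le_rfl, hc1.le, h1, by simpa using h2⟩ : (0, z) ∈ O ∩ _).1
  have hlam : c1 / x ≤ 1 := (div_le_one hx0).2 hx.le
  have hcomb : ∀ z, 0 ≤ z → z ≤ c0 → 0 ≤ (1 - c1 / x) * z + c1 / x * y ∧
      (1 - c1 / x) * z + c1 / x * y ≤ c2 := by
    intro z h1 h2
    have h := hconv (hmem z h1 h2) hy (sub_nonneg.2 hlam) (by positivity : 0 ≤ c1 / x) (by ring)
    have hfst : c1 / x * x = c1 := by field_simp
    simp only [Prod.smul_mk, Prod.mk_add_mk, smul_eq_mul, mul_zero, zero_add, hfst] at h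
    have h' := hslice.le ⟨h, le_refl c1⟩
    refine ⟨h'.2.2.1, h'.2.2.2.trans_eq ?_⟩
    simp only; field_simp; ring
  constructor
  · have h := (hcomb 0 le_rfl hc0).1
    rw [mul_zero, zero_add] at h
    exact nonneg_of_mul_nonneg_right h (by positivity)
  · have h := (hcomb c0 hc0 le_rfl).2
    have h2 := mul_le_mul_of_nonneg_right h (by positivity : 0 ≤ x / c1)
    have e : ((1 - c1 / x) * c0 + c1 / x * y) * (x / c1) = (x / c1 - 1) * c0 + y := by
      field_simp
    have e2 : c2 * (x / c1) = (c2 - c0) / c1 * x + c0 + (x / c1 - 1) * c0 := by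
      field_simp; ring
    linarith

/-- The integral of `y` over an interval `[l, h]` below height `g`, compared with that of the
interval `[L, g]` after subtracting the reference height `L`. -/
lemma sq_sub_sq_half_le {l h g L : ℝ} (hlh : l ≤ h) (hhg : h ≤ g) :
    (h ^ 2 - l ^ 2) / 2 ≤ L * (h - l) + (max (g - L) 0) ^ 2 / 2 := by
  have h1 : h - L ≤ max (g - L) 0 := le_trans (by linarith) (le_max_left _ _)
  have h0 : 0 ≤ max (g - L) 0 := le_max_right _ _
  by_cases hL : L ≤ h
  · nlinarith [sq_nonneg (l - L)]
  · push Not at hL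
    nlinarith

/-- Second coordinate bound for the barycenter of a convex set: let
`V, c₁, c₂ > 0`, `0 ≤ c₀ ≤ c₂`, and let `𝐎 ⊂ ℝ²` be a compact convex set of
area `V` whose intersection with `{x₁ ≤ c₁}` is the trapezoid
`{0 ≤ x₁ ≤ c₁, 0 ≤ x₂ ≤ ((c₂−c₀)/c₁)x₁ + c₀}`. Then the first coordinate
`b₂` of the barycenter satisfies
`b₂ ≤ (−c₀³c₁² + 4c₀²c₁V − 4c₀V² + 4c₂V²)/(6c₁c₂V)`. -/
theorem stmt3 (V c0 c1 c2 : ℝ) (hV : 0 < V) (hc1 : 0 < c1) (hc2 : 0 < c2)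
    (hc0 : 0 ≤ c0) (hc02 : c0 ≤ c2)
    (O : Set (ℝ × ℝ)) (hcpt : IsCompact O) (hconv : Convex ℝ O)
    (harea : (volume O).toReal = V)
    (hslice : O ∩ {p : ℝ × ℝ | p.1 ≤ c1} =
      {p : ℝ × ℝ | 0 ≤ p.1 ∧ p.1 ≤ c1 ∧ 0 ≤ p.2 ∧
        p.2 ≤ (c2 - c0) / c1 * p.1 + c0})
    (b2 : ℝ) (hb2 : b2 = (∫ p in O, p.2 ∂volume) / V) :
    b2 ≤ (-(c0 ^ 3) * c1 ^ 2 + 4 * c0 ^ 2 * c1 * V - 4 * c0 * V ^ 2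
        + 4 * c2 * V ^ 2) / (6 * c1 * c2 * V) := by
  have hbounds : ∀ {x y : ℝ}, c1 < x → (x, y) ∈ O → 0 ≤ y ∧ y ≤ (c2 - c0) / c1 * x + c0 :=
    fun hx hy => snd_mem_of_trapezoid_slice hc1 hc0 hconv hslice hx hy
  have hsc : (c2 - c0) / c1 * c1 = c2 - c0 := by field_simp
  have hs0 : 0 ≤ (c2 - c0) / c1 := div_nonneg (by linarith) hc1.le
  set s := (c2 - c0) / c1 with hs
  have hOm : MeasurableSet O := hcpt.isClosed.measurableSet
  have hOint : ∀ {f : ℝ × ℝ → ℝ}, Continuous f → Integrable (O.indicator f)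
      ((volume : Measure ℝ).prod volume) := fun hf =>
    (integrable_indicator_iff hOm).2 (hf.continuousOn.integrableOn_compact hcpt)
  set w : ℝ → ℝ := fun x => ∫ y, O.indicator (fun _ => (1 : ℝ)) (x, y) with hw
  set J : ℝ → ℝ := fun x => ∫ y, O.indicator (fun p => p.2) (x, y) with hJ
  have hwi : Integrable w := (hOint continuous_const).integral_prod_left
  have hJi : Integrable J := (hOint continuous_snd).integral_prod_left
  have hxwi : Integrable fun x => x * w x := by
    refine (hOint continuous_fst).integral_prod_left.congr (.of_forall fun x => ?_)
    simp only [hw]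
    rw [← integral_const_mul]
    congr 1 with y
    by_cases h : (x, y) ∈ O <;> simp [h]
  have hwV : ∫ x, w x = V := by
    rw [hw, ← integral_prod _ (hOint continuous_const), ← Measure.volume_eq_prod,
      integral_indicator hOm, setIntegral_const, smul_eq_mul, mul_one, measureReal_def, harea]
  have hJM : ∫ x, J x = ∫ p in O, p.2 := by
    rw [hJ, ← integral_prod _ (hOint continuous_snd), ← Measure.volume_eq_prod,
      integral_indicator hOm]
  have hwJ : ∀ {x l h : ℝ}, l ≤ h → Prod.mk x ⁻¹' O = Set.Icc l h →
      w x = h - l ∧ J x = (h ^ 2 - l ^ 2) / 2 := by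
    intro x l h hlh hI
    exact ⟨by simp [hw, integral_indicator_slice _ hlh hI],
      by simp [hJ, integral_indicator_slice _ hlh hI]⟩
  have hwJe : ∀ {x : ℝ}, Prod.mk x ⁻¹' O = ∅ → w x = 0 ∧ J x = 0 := fun he =>
    ⟨integral_indicator_slice_empty _ he, integral_indicator_slice_empty _ he⟩
  have hneg : ∀ x < 0, w x = 0 ∧ J x = 0 := by
    intro x hx
    refine hwJe (Set.eq_empty_of_forall_notMem fun y hy => ?_)
    have h := hslice.le ⟨hy, (hx.trans hc1).le⟩
    exact absurd h.1 (not_le.2 hx)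
  have hleft : ∀ x, 0 ≤ x → x ≤ c1 → Prod.mk x ⁻¹' O = Set.Icc 0 (s * x + c0) := by
    intro x h0 h1
    ext y
    constructor
    · intro hy
      have h := hslice.le ⟨hy, h1⟩
      exact ⟨h.2.2.1, h.2.2.2⟩
    · intro hy
      exact (hslice.ge ⟨h0, h1, hy.1, hy.2⟩ : (x, y) ∈ O ∩ _).1
  have hwJl : ∀ x, 0 ≤ x → x ≤ c1 → w x = s * x + c0 ∧ J x = (s * x + c0) ^ 2 / 2 := by
    intro x h0 h1
    have h := hwJ (by positivity) (hleft x h0 h1)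
    simpa using h
  have hw0 : ∀ x, 0 ≤ w x := fun x =>
    integral_nonneg fun y => Set.indicator_nonneg (fun _ _ => zero_le_one) _
  have hwl : ∫ x in Set.Iic c1, w x = c1 * (c0 + c2) / 2 := by
    rw [setIntegral_Iic_eq_of_zero_of_neg hc1.le (fun x hx => (hneg x hx).1)
      (fun x h0 h1 => (hwJl x h0 h1).1),
      intervalIntegral.integral_eq_sub_of_hasDerivAt (f := fun x => s * x ^ 2 / 2 + c0 * x)]
    · rw [hs]; field_simp; ring
    · intro x _
      refine ((((hasDerivAt_id x).pow 2).const_mul s).div_const 2 |>.add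
        ((hasDerivAt_id x).const_mul c0)).congr_deriv ?_
      simp only [id]; ring
    · exact (by fun_prop : Continuous fun x => s * x + c0).intervalIntegrable _ _
  have hJl : ∫ x in Set.Iic c1, J x = c1 * (c0 ^ 2 + c0 * c2 + c2 ^ 2) / 6 := by
    rw [setIntegral_Iic_eq_of_zero_of_neg hc1.le (fun x hx => (hneg x hx).2)
      (fun x h0 h1 => (hwJl x h0 h1).2),
      intervalIntegral.integral_eq_sub_of_hasDerivAt
        (f := fun x => s ^ 2 * x ^ 3 / 6 + s * c0 * x ^ 2 / 2 + c0 ^ 2 * x / 2)]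
    · rw [hs]; field_simp; ring
    · intro x _
      refine ((((hasDerivAt_id x).pow 3).const_mul (s ^ 2)).div_const 6 |>.add
        ((((hasDerivAt_id x).pow 2).const_mul (s * c0)).div_const 2) |>.add
        (((hasDerivAt_id x).const_mul (c0 ^ 2)).div_const 2)).congr_deriv ?_
      simp only [id]; ring
    · exact (by fun_prop : Continuous fun x => (s * x + c0) ^ 2 / 2).intervalIntegrable _ _
  have hright : ∀ x, c1 < x → (w x = 0 ∧ J x = 0) ∨ ∃ l h, l ≤ h ∧ h ≤ s * x + c0 ∧
      Prod.mk x ⁻¹' O = Set.Icc l h ∧ w x = h - l ∧ J x = (h ^ 2 - l ^ 2) / 2 := by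
    intro x hx
    rcases slice_eq_empty_or_Icc hcpt hconv x with he | ⟨l, h, hlh, hI⟩
    · exact .inl (hwJe he)
    · have hh : h ∈ Prod.mk x ⁻¹' O := hI ▸ Set.right_mem_Icc.2 hlh
      exact .inr ⟨l, h, hlh, (hbounds hx hh).2, hI, hwJ hlh hI⟩
  obtain ⟨τ, hτ⟩ : ∃ τ, τ = (2 * V - c1 * (c0 + c2)) / c2 := ⟨_, rfl⟩
  have hVτ : V = c2 * τ / 2 + c1 * (c0 + c2) / 2 := by rw [hτ]; field_simp; ring
  have hsplit : ∀ {F : ℝ → ℝ}, Integrable F →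
      (∫ x in Set.Iic c1, F x) + ∫ x in Set.Ioi c1, F x = ∫ x, F x := fun hF =>
    intervalIntegral.integral_Iic_add_Ioi hF.integrableOn hF.integrableOn
  have hwr : ∫ x in Set.Ioi c1, w x = c2 * τ / 2 := by
    have := hsplit hwi
    linarith
  have hτ0 : 0 ≤ τ := by
    have : 0 ≤ c2 * τ / 2 := hwr ▸ integral_nonneg hw0
    by_contra! h
    nlinarith
  have hJr : ∫ x in Set.Ioi c1, J x ≤ c2 ^ 2 * τ / 3 + c2 * s * τ ^ 2 / 6 := by
    rcases hτ0.eq_or_lt with h0 | hpos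
    · rw [← h0] at hwr ⊢
      have hae := (integral_eq_zero_iff_of_nonneg hw0 hwi.integrableOn).1 (by simpa using hwr)
      refine (integral_eq_zero_of_ae ?_).le.trans (by simp)
      filter_upwards [hae, ae_restrict_mem measurableSet_Ioi] with x hx hxc
      rcases hright x hxc with h | ⟨l, h, -, -, -, h1, h2⟩
      · exact h.2
      · have : h = l := by
          have hx' : w x = 0 := hx
          linarith
        rw [h2, this]; simp
    · have hstar : ∀ x, c1 < x → 0 < w x → ∀ v, c1 < v → v ≤ x →
          (x - v) * c2 + (v - c1) * w x ≤ (x - c1) * w v := by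
        intro x hx hwx v hv hvx
        rcases hright x hx with h | ⟨l, h, hlh, -, hI, h1, -⟩
        · exact absurd h.1 hwx.ne'
        have hxc : 0 < x - c1 := sub_pos.2 hx
        set r := (v - c1) / (x - c1) with hr
        have hr0 : 0 ≤ r := div_nonneg (by linarith) hxc.le
        have hr1 : 0 ≤ 1 - r := by rw [sub_nonneg, div_le_one hxc]; linarith
        have hcomb : ∀ y z, 0 ≤ z → z ≤ c2 → y ∈ Set.Icc l h →
            (1 - r) * z + r * y ∈ Prod.mk v ⁻¹' O := by
          intro y z hz0 hz2 hy
          have hz : z ∈ Prod.mk c1 ⁻¹' O := by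
            rw [hleft c1 hc1.le le_rfl, hsc]
            exact ⟨hz0, by linarith⟩
          have hy' : y ∈ Prod.mk x ⁻¹' O := hI ▸ hy
          have hc := hconv hz hy' hr1 hr0 (by ring)
          have e : (1 - r) * c1 + r * x = v := by rw [hr]; field_simp; ring
          simpa [Prod.smul_mk, e] using hc
        have hlo := hcomb l 0 le_rfl hc2.le (Set.left_mem_Icc.2 hlh)
        have hhi := hcomb h c2 hc2.le le_rfl (Set.right_mem_Icc.2 hlh)
        rcases slice_eq_empty_or_Icc hcpt hconv v with he | ⟨l', h', hlh', hI'⟩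
        · rw [he] at hlo; exact absurd hlo (Set.notMem_empty _)
        have hwv := (hwJ hlh' hI').1
        rw [hI'] at hlo hhi
        have hle : (1 - r) * c2 + r * w x ≤ w v := by
          rw [h1, hwv]; linarith [hlo.1, hhi.2]
        have h5 := mul_le_mul_of_nonneg_left hle hxc.le
        have e : (x - c1) * ((1 - r) * c2 + r * w x) = (x - v) * c2 + (v - c1) * w x := by
          rw [hr]; field_simp; ring
        linarith
      have hmom := setIntegral_first_moment_le_of_star hpos hw0 hwi hxwi hstar hwr
      set P : ℝ → ℝ := fun x => (c2 * (1 - (x - c1) / τ)) ^ 2 / 2 with hP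
      have hPc : Continuous P := by fun_prop
      set m := c2 / τ + s with hm
      have hPi : Integrable ((Set.Ioc c1 (c1 + τ)).indicator P) :=
        (integrable_indicator_iff measurableSet_Ioc).2 hPc.integrableOn_Ioc
      have hmi : Integrable fun x => m * ((x - c1) * w x) := by
        refine ((hxwi.sub (hwi.const_mul c1)).const_mul m).congr (.of_forall fun x => ?_)
        simp only [Pi.sub_apply]; ring
      have hPint : ∫ x in Set.Ioi c1, (Set.Ioc c1 (c1 + τ)).indicator P x = c2 ^ 2 * τ / 6 := by
        rw [setIntegral_indicator measurableSet_Ioc, Set.inter_eq_right.2 fun x hx => hx.1,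
          ← intervalIntegral.integral_of_le (by linarith),
          intervalIntegral.integral_eq_sub_of_hasDerivAt
            (f := fun x => -(c2 ^ 2 * τ / 6) * (1 - (x - c1) / τ) ^ 3)]
        · field_simp; ring
        · intro x _
          refine ((((((hasDerivAt_id x).sub_const c1).div_const τ).const_sub 1).pow 3).const_mul
            (-(c2 ^ 2 * τ / 6))).congr_deriv ?_
          simp only [hP, id, Nat.add_one_sub_one, Nat.cast_ofNat]
          field_simp
          ring
        · exact hPc.intervalIntegrable _ _
      have hle : ∫ x in Set.Ioi c1, J x ≤
          ∫ x in Set.Ioi c1, (m * ((x - c1) * w x) + (Set.Ioc c1 (c1 + τ)).indicator P x) := by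
        refine setIntegral_mono_on hJi.integrableOn (hmi.add hPi).integrableOn
          measurableSet_Ioi fun x hx => ?_
        have hxc : c1 < x := hx
        have hgL : s * x + c0 - m * (x - c1) = c2 * (1 - (x - c1) / τ) := by
          have : s * x = s * (x - c1) + (c2 - c0) := by rw [← hsc]; ring
          rw [this, hm]; ring
        have hmax : (max (s * x + c0 - m * (x - c1)) 0) ^ 2 / 2 =
            (Set.Ioc c1 (c1 + τ)).indicator P x := by
          rw [hgL]
          by_cases hxt : x ≤ c1 + τ
          · rw [Set.indicator_of_mem (Set.mem_Ioc.2 ⟨hxc, hxt⟩), max_eq_left]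
            exact mul_nonneg hc2.le (by rw [sub_nonneg, div_le_one hpos]; linarith)
          · rw [Set.indicator_of_notMem (fun h => hxt h.2), max_eq_right]
            · simp
            · exact mul_nonpos_of_nonneg_of_nonpos hc2.le
                (by rw [sub_nonpos, one_le_div hpos]; linarith)
        rw [← hmax]
        rcases hright x hxc with h | ⟨l, h, hlh, hg, -, h1, h2⟩
        · rw [h.1, h.2]; positivity
        · rw [h1, h2, ← mul_assoc]
          exact sq_sub_sq_half_le hlh hg
      rw [integral_add hmi.integrableOn hPi.integrableOn, integral_const_mul, hPint] at hle
      have hm0 : 0 ≤ m := by positivity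
      have h6 := mul_le_mul_of_nonneg_left hmom hm0
      have e : m * (c2 * τ ^ 2 / 6) = c2 ^ 2 * τ / 6 + c2 * s * τ ^ 2 / 6 := by
        rw [hm]; field_simp
      linarith
  have hM : ∫ p in O, p.2 ≤ c1 * (c0 ^ 2 + c0 * c2 + c2 ^ 2) / 6 +
      (c2 ^ 2 * τ / 3 + c2 * s * τ ^ 2 / 6) := by
    rw [← hJM, ← hsplit hJi, hJl]
    linarith
  have hfin : (-(c0 ^ 3) * c1 ^ 2 + 4 * c0 ^ 2 * c1 * V - 4 * c0 * V ^ 2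
        + 4 * c2 * V ^ 2) / (6 * c1 * c2) = c1 * (c0 ^ 2 + c0 * c2 + c2 ^ 2) / 6 +
      (c2 ^ 2 * τ / 3 + c2 * s * τ ^ 2 / 6) := by
    rw [hVτ, hs]; field_simp; ring
  rw [hb2, ← div_div]
  refine div_le_div_of_nonneg_right ?_ hV.le
  rw [hfin]
  exact hM
end

section
/- Let V, c_1, c_2 > 0 and 0 ≤ c_0 ≤ c_2, and let 𝐎 ⊂ ℝ² be the convex hull of the four points (0, c_0), (0, 0), (c_1, 0), and ((2V − c_0c_1)/c_2, (2c_2V − c_0(2V − c_0c_1))/(c_1c_2)), where we assume c_1(c_0 + c_2)/2 ≤ V. Then 𝐎 has area V and its barycenter (b_1, b_2) satisfies b_1 = (c_0²c_1² − 4c_0c_1V + 2c_1c_2V + 4V²)/(6 c_2 V) and b_2 = (−c_0³c_1² + 4c_0²c_1V − 4c_0V² + 4c_2V²)/(6 c_1 c_2 V). -/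
open MeasureTheory

/-- A closed region between the graphs of two continuous functions is compact. -/
theorem isCompact_closedRegionBetween {f g : ℝ → ℝ} (hf : Continuous f) (hg : Continuous g)
    (u v : ℝ) :
    IsCompact {p : ℝ × ℝ | p.1 ∈ Set.Icc u v ∧ p.2 ∈ Set.Icc (f p.1) (g p.1)} := by
  have h : {p : ℝ × ℝ | p.1 ∈ Set.Icc u v ∧ p.2 ∈ Set.Icc (f p.1) (g p.1)} =
      (fun q : ℝ × ℝ => (q.1, (1 - q.2) * f q.1 + q.2 * g q.1)) ''
        ({x | x ∈ Set.Icc u v ∧ f x ≤ g x} ×ˢ Set.Icc 0 1) := by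
    ext ⟨x, y⟩
    simp only [Set.mem_ofPred_eq, Set.mem_image, Set.mem_prod, Prod.mk.injEq, Prod.exists]
    constructor
    · rintro ⟨hx, hy⟩
      have hfg : f x ≤ g x := hy.1.trans hy.2
      have hmem : y ∈ segment ℝ (f x) (g x) := by rwa [segment_eq_Icc hfg]
      obtain ⟨s, t, hs, ht, hst, rfl⟩ := hmem
      refine ⟨x, t, ⟨⟨hx, hfg⟩, ht, by linarith⟩, rfl, ?_⟩
      rw [← eq_sub_of_add_eq hst]
      simp
    · rintro ⟨x', t, ⟨⟨hx, hfg⟩, ht0, ht1⟩, rfl, rfl⟩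
      refine ⟨hx, ?_, ?_⟩ <;> nlinarith
  rw [h]
  refine IsCompact.image (IsCompact.prod ?_ isCompact_Icc) (by fun_prop)
  exact isCompact_Icc.inter_right (isClosed_le hf hg)

/-- Fubini's theorem on a closed region between two graphs. -/
theorem setIntegral_closedRegionBetween {f g : ℝ → ℝ} (hf : Continuous f) (hg : Continuous g)
    {u v : ℝ} (huv : u ≤ v) (hfg : ∀ x ∈ Set.Icc u v, f x ≤ g x) {h : ℝ × ℝ → ℝ}
    (hh : Continuous h) :
    ∫ p in {p : ℝ × ℝ | p.1 ∈ Set.Icc u v ∧ p.2 ∈ Set.Icc (f p.1) (g p.1)}, h p =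
      ∫ x in u..v, ∫ y in f x..g x, h (x, y) := by
  have hK := isCompact_closedRegionBetween hf hg u v
  have hi := (hh.continuousOn.integrableOn_compact (μ := volume) hK).integrable_indicator
    hK.measurableSet
  rw [← integral_indicator hK.measurableSet]
  rw [Measure.volume_eq_prod] at hi ⊢
  rw [integral_prod _ hi, intervalIntegral.integral_of_le huv, ← integral_Icc_eq_integral_Ioc,
    ← integral_indicator measurableSet_Icc]
  congr 1 with x
  by_cases hx : x ∈ Set.Icc u v
  · rw [Set.indicator_of_mem hx, intervalIntegral.integral_of_le (hfg x hx),
      ← integral_Icc_eq_integral_Ioc, ← integral_indicator measurableSet_Icc]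
    congr 1 with y
    simp only [Set.indicator, Set.mem_ofPred_eq, hx, true_and]
  · rw [Set.indicator_of_notMem hx]
    simp only [Set.indicator, Set.mem_ofPred_eq, hx, false_and, if_false, integral_zero]

theorem integral_quadratic (A B C u v : ℝ) :
    ∫ x in u..v, (A + B * x + C * x ^ 2) =
      A * (v - u) + B * (v ^ 2 - u ^ 2) / 2 + C * (v ^ 3 - u ^ 3) / 3 := by
  rw [intervalIntegral.integral_add (by apply Continuous.intervalIntegrable; fun_prop)
      (by apply Continuous.intervalIntegrable; fun_prop),
    intervalIntegral.integral_add (by apply Continuous.intervalIntegrable; fun_prop)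
      (by apply Continuous.intervalIntegrable; fun_prop)]
  rw [intervalIntegral.integral_const_mul, intervalIntegral.integral_const_mul, integral_id,
    integral_pow, intervalIntegral.integral_const, smul_eq_mul]
  norm_num
  ring

theorem integral_of_eqOn_quadratics {F : ℝ → ℝ} (hF : Continuous F) {u v w : ℝ}
    (huv : u ≤ v) (hvw : v ≤ w) (A B C A' B' C' : ℝ)
    (h₁ : ∀ x ∈ Set.Icc u v, F x = A + B * x + C * x ^ 2)
    (h₂ : ∀ x ∈ Set.Icc v w, F x = A' + B' * x + C' * x ^ 2) :
    ∫ x in u..w, F x =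
      A * (v - u) + B * (v ^ 2 - u ^ 2) / 2 + C * (v ^ 3 - u ^ 3) / 3 +
      (A' * (w - v) + B' * (w ^ 2 - v ^ 2) / 2 + C' * (w ^ 3 - v ^ 3) / 3) := by
  rw [← intervalIntegral.integral_add_adjacent_intervals (hF.intervalIntegrable u v)
    (hF.intervalIntegrable v w), ← integral_quadratic, ← integral_quadratic]
  congr 1
  · exact intervalIntegral.integral_congr (by rwa [Set.uIcc_of_le huv])
  · exact intervalIntegral.integral_congr (by rwa [Set.uIcc_of_le hvw])

theorem Convex.lineMap_mk_mem {S : Set (ℝ × ℝ)} (hS : Convex ℝ S) {p q r s t x y : ℝ}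
    (h₁ : (p, q) ∈ S) (h₂ : (r, s) ∈ S) (ht0 : 0 ≤ t) (ht1 : t ≤ 1)
    (hx : x = (1 - t) * p + t * r) (hy : y = (1 - t) * q + t * s) : (x, y) ∈ S := by
  have := hS h₁ h₂ (sub_nonneg.2 ht1) ht0 (sub_add_cancel 1 t)
  simpa [hx, hy] using this

theorem Convex.mk_mem_of_le_of_le {S : Set (ℝ × ℝ)} (hS : Convex ℝ S) {x y y₁ y₂ : ℝ}
    (h₁ : (x, y₁) ∈ S) (h₂ : (x, y₂) ∈ S) (hy₁ : y₁ ≤ y) (hy₂ : y ≤ y₂) : (x, y) ∈ S := by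
  have hmem : y ∈ segment ℝ y₁ y₂ := by
    rw [segment_eq_Icc (hy₁.trans hy₂)]
    exact ⟨hy₁, hy₂⟩
  obtain ⟨s, t, hs, ht, hst, rfl⟩ := hmem
  exact hS.lineMap_mk_mem h₁ h₂ ht (by linarith) (by ring)
    (by rw [← eq_sub_of_add_eq hst]; simp)

/-- When `a = c`, the right edge is vertical and the slope `b / (a - c)` is zero by convention,
so the description is still correct. -/
theorem convexHull_quadrilateral_eq {a b c d : ℝ} (hc : 0 < c) (hd : 0 ≤ d) (hca : c ≤ a)
    (hdb : d ≤ b) :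
    convexHull ℝ {((0 : ℝ), d), ((0 : ℝ), (0 : ℝ)), (c, (0 : ℝ)), (a, b)} =
      {p : ℝ × ℝ | p.1 ∈ Set.Icc 0 a ∧
        p.2 ∈ Set.Icc (max 0 (b / (a - c) * (p.1 - c))) (d + (b - d) / a * p.1)} := by
  have ha : 0 < a := hc.trans_le hca
  have hb : 0 ≤ b := hd.trans hdb
  have hm : 0 ≤ b / (a - c) := div_nonneg hb (sub_nonneg.2 hca)
  have hk : 0 ≤ (b - d) / a := div_nonneg (sub_nonneg.2 hdb) ha.le
  have hka : (b - d) / a * a = b - d := div_mul_cancel₀ _ ha.ne'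
  have hma : b / (a - c) * (a - c) ≤ b := by
    rcases hca.eq_or_lt with rfl | h
    · simpa using hb
    · exact (div_mul_cancel₀ _ (sub_pos.2 h).ne').le
  apply Set.Subset.antisymm
  · apply convexHull_min
    · simp only [Set.insert_subset_iff, Set.singleton_subset_iff, Set.mem_ofPred_eq, Set.mem_Icc,
        max_le_iff]
      refine ⟨⟨⟨le_rfl, ha.le⟩, ⟨hd, ?_⟩, ?_⟩, ⟨⟨le_rfl, ha.le⟩, ⟨le_rfl, ?_⟩, ?_⟩,
        ⟨⟨hc.le, hca⟩, ⟨le_rfl, ?_⟩, ?_⟩, ⟨ha.le, le_rfl⟩, ⟨hb, hma⟩, ?_⟩ <;> nlinarith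
    · rintro ⟨x, y⟩ hp ⟨z, w⟩ hq s t hs ht hst
      simp only [Set.mem_ofPred_eq, Set.mem_Icc, max_le_iff, Prod.smul_mk, Prod.mk_add_mk,
        smul_eq_mul] at hp hq ⊢
      generalize b / (a - c) = m at *
      generalize (b - d) / a = k at *
      obtain ⟨⟨h1, h2⟩, ⟨h3, h4⟩, h5⟩ := hp
      obtain ⟨⟨g1, g2⟩, ⟨g3, g4⟩, g5⟩ := hq
      obtain rfl : s = 1 - t := by linarith
      refine ⟨⟨by positivity, ?_⟩, ⟨by positivity, ?_⟩, ?_⟩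
      · linarith [mul_le_mul_of_nonneg_left h2 hs, mul_le_mul_of_nonneg_left g2 ht]
      · linarith [mul_le_mul_of_nonneg_left h4 hs, mul_le_mul_of_nonneg_left g4 ht]
      · linarith [mul_le_mul_of_nonneg_left h5 hs, mul_le_mul_of_nonneg_left g5 ht]
  · rintro ⟨x, y⟩ ⟨⟨hx0, hxa⟩, hly, hyu⟩
    simp only at hx0 hxa hly hyu
    set S := convexHull ℝ {((0 : ℝ), d), ((0 : ℝ), (0 : ℝ)), (c, (0 : ℝ)), (a, b)} with hS
    have hconv : Convex ℝ S := convex_convexHull ℝ _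
    have h₁ : ((0 : ℝ), d) ∈ S := subset_convexHull ℝ _ (by simp)
    have h₂ : ((0 : ℝ), (0 : ℝ)) ∈ S := subset_convexHull ℝ _ (by simp)
    have h₃ : (c, (0 : ℝ)) ∈ S := subset_convexHull ℝ _ (by simp)
    have h₄ : (a, b) ∈ S := subset_convexHull ℝ _ (by simp)
    refine hconv.mk_mem_of_le_of_le ?_ ?_ hly hyu
    · rcases le_or_gt x c with hxc | hcx
      · rw [max_eq_left (mul_nonpos_of_nonneg_of_nonpos hm (sub_nonpos.2 hxc))]
        exact hconv.lineMap_mk_mem h₂ h₃ (div_nonneg hx0 hc.le) (div_le_one_of_le₀ hxc hc.le)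
          (by field_simp; ring) (by ring)
      · have hac : 0 < a - c := by linarith
        rw [max_eq_right (mul_nonneg hm (sub_nonneg.2 hcx.le))]
        exact hconv.lineMap_mk_mem h₃ h₄ (t := (x - c) / (a - c))
          (div_nonneg (by linarith) hac.le) (div_le_one_of_le₀ (by linarith) hac.le)
          (by field_simp; ring) (by field_simp; ring)
    · exact hconv.lineMap_mk_mem h₁ h₄ (div_nonneg hx0 ha.le) (div_le_one_of_le₀ hxa ha.le)
        (by field_simp; ring) (by field_simp; ring)

/-- Area and first moments of a convex quadrilateral with two edges on the coordinate axes. -/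
theorem convexHull_quadrilateral_moments {a b c d : ℝ} (hc : 0 < c) (hd : 0 ≤ d) (hca : c ≤ a)
    (hdb : d ≤ b) {O : Set (ℝ × ℝ)}
    (hO : O = convexHull ℝ {((0 : ℝ), d), ((0 : ℝ), (0 : ℝ)), (c, (0 : ℝ)), (a, b)}) :
    (volume O).toReal = (c * b + a * d) / 2 ∧
    ∫ p in O, p.1 = (c * b * (c + a) + a * d * a) / 6 ∧
    ∫ p in O, p.2 = (c * b * b + a * d * (b + d)) / 6 := by
  rw [convexHull_quadrilateral_eq hc hd hca hdb] at hO
  have ha : 0 < a := hc.trans_le hca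
  have hb : 0 ≤ b := hd.trans hdb
  have hm : 0 ≤ b / (a - c) := div_nonneg hb (sub_nonneg.2 hca)
  have hk : 0 ≤ (b - d) / a := div_nonneg (sub_nonneg.2 hdb) ha.le
  have hka : (b - d) / a * a = b - d := div_mul_cancel₀ _ ha.ne'
  have hma : b / (a - c) * (a - c) ^ 2 = b * (a - c) := by
    rcases hca.eq_or_lt with rfl | h
    · simp
    · have := (sub_pos.2 h).ne'
      field_simp
  have hma' : b / (a - c) * (a - c) ≤ b := by
    rcases hca.eq_or_lt with rfl | h
    · simpa using hb
    · exact (div_mul_cancel₀ _ (sub_pos.2 h).ne').le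
  have hmm : (b / (a - c)) ^ 2 * (a - c) ^ 3 = b ^ 2 * (a - c) := by
    rcases hca.eq_or_lt with rfl | h
    · simp
    · have := (sub_pos.2 h).ne'
      field_simp
  generalize b / (a - c) = m at *
  generalize (b - d) / a = k at *
  have hfg : ∀ x ∈ Set.Icc 0 a, max 0 (m * (x - c)) ≤ d + k * x := by
    rintro x ⟨hx0, hxa⟩
    refine max_le (by positivity) (sub_nonneg.1 (nonneg_of_mul_nonneg_right ?_ ha))
    have h₀ : 0 ≤ (a - x) * (d + m * c) :=
      mul_nonneg (sub_nonneg.2 hxa) (add_nonneg hd (mul_nonneg hm hc.le))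
    have h₁ : 0 ≤ x * (b - m * (a - c)) := mul_nonneg hx0 (sub_nonneg.2 hma')
    linear_combination h₀ + h₁ - x * hka
  have hlow : ∀ x ∈ Set.Icc 0 c, max 0 (m * (x - c)) = 0 := fun x hx =>
    max_eq_left (mul_nonpos_of_nonneg_of_nonpos hm (sub_nonpos.2 hx.2))
  have hhigh : ∀ x ∈ Set.Icc c a, max 0 (m * (x - c)) = m * (x - c) := fun x hx =>
    max_eq_right (mul_nonneg hm (sub_nonneg.2 hx.1))
  have hf : Continuous fun x : ℝ => max 0 (m * (x - c)) := by fun_prop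
  have hg : Continuous fun x : ℝ => d + k * x := by fun_prop
  have hint : ∀ h : ℝ × ℝ → ℝ, Continuous h → ∫ p in O, h p =
      ∫ x in 0..a, ∫ y in max 0 (m * (x - c))..d + k * x, h (x, y) := fun h hh => by
    rw [hO]
    exact setIntegral_closedRegionBetween hf hg ha.le hfg hh
  refine ⟨?_, ?_, ?_⟩
  · have h := hint (fun _ => 1) continuous_const
    rw [setIntegral_const, smul_eq_mul, mul_one] at h
    change volume.real O = _
    rw [h]
    simp only [intervalIntegral.integral_const, smul_eq_mul, mul_one]
    rw [integral_of_eqOn_quadratics (by fun_prop) hc.le hca d k 0 (d + m * c) (k - m) 0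
      (fun x hx => by rw [hlow x hx]; ring) (fun x hx => by rw [hhigh x hx]; ring)]
    linear_combination a / 2 * hka - hma / 2
  · rw [hint _ continuous_fst]
    simp only [intervalIntegral.integral_const, smul_eq_mul]
    rw [integral_of_eqOn_quadratics (by fun_prop) hc.le hca 0 d k 0 (d + m * c) (k - m)
      (fun x hx => by rw [hlow x hx]; ring) (fun x hx => by rw [hhigh x hx]; ring)]
    linear_combination a ^ 2 / 3 * hka - (2 * a + c) / 6 * hma
  · rw [hint _ continuous_snd]
    simp only [integral_id]
    rw [integral_of_eqOn_quadratics (by fun_prop) hc.le hca (d ^ 2 / 2) (d * k) (k ^ 2 / 2)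
      (d ^ 2 / 2 - m ^ 2 * c ^ 2 / 2) (d * k + m ^ 2 * c) (k ^ 2 / 2 - m ^ 2 / 2)
      (fun x hx => by rw [hlow x hx]; ring) (fun x hx => by rw [hhigh x hx]; ring)]
    linear_combination (d * a / 2 + a / 6 * (k * a + (b - d))) * hka - hmm / 6

/-- The extremal quadrilateral attains both barycenter bounds: let
`V, c₁, c₂ > 0`, `0 ≤ c₀ ≤ c₂` with `c₁(c₀ + c₂)/2 ≤ V`, and let `𝐎` be the
convex hull of `(0, c₀)`, `(0, 0)`, `(c₁, 0)` and
`((2V − c₀c₁)/c₂, (2c₂V − c₀(2V − c₀c₁))/(c₁c₂))`. Then `𝐎` has area `V` and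
its barycenter `(b₁, b₂)` is given by
`b₁ = (c₀²c₁² − 4c₀c₁V + 2c₁c₂V + 4V²)/(6c₂V)` and
`b₂ = (−c₀³c₁² + 4c₀²c₁V − 4c₀V² + 4c₂V²)/(6c₁c₂V)`. -/
theorem stmt4 (V c0 c1 c2 : ℝ) (hV : 0 < V) (hc1 : 0 < c1) (hc2 : 0 < c2)
    (hc0 : 0 ≤ c0) (hc02 : c0 ≤ c2) (hVlb : c1 * (c0 + c2) / 2 ≤ V)
    (O : Set (ℝ × ℝ))
    (hO : O = convexHull ℝ
      {((0 : ℝ), c0), ((0 : ℝ), (0 : ℝ)), (c1, (0 : ℝ)),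
        ((2 * V - c0 * c1) / c2,
          (2 * c2 * V - c0 * (2 * V - c0 * c1)) / (c1 * c2))}) :
    (volume O).toReal = V ∧
    (∫ p in O, p.1 ∂volume) / V =
      (c0 ^ 2 * c1 ^ 2 - 4 * c0 * c1 * V + 2 * c1 * c2 * V + 4 * V ^ 2)
        / (6 * c2 * V) ∧
    (∫ p in O, p.2 ∂volume) / V =
      (-(c0 ^ 3) * c1 ^ 2 + 4 * c0 ^ 2 * c1 * V - 4 * c0 * V ^ 2
        + 4 * c2 * V ^ 2) / (6 * c1 * c2 * V) := by
  have hca : c1 ≤ (2 * V - c0 * c1) / c2 := by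
    rw [le_div_iff₀ hc2]
    linarith
  have hdb : c0 ≤ (2 * c2 * V - c0 * (2 * V - c0 * c1)) / (c1 * c2) := by
    rw [le_div_iff₀ (mul_pos hc1 hc2)]
    have h : 0 ≤ (c2 - c0) * (2 * V - c0 * c1) :=
      mul_nonneg (sub_nonneg.2 hc02) (by linarith [mul_pos hc1 hc2])
    linarith
  obtain ⟨h₀, h₁, h₂⟩ := convexHull_quadrilateral_moments hc1 hc0 hca hdb hO
  rw [h₀, h₁, h₂]
  refine ⟨?_, ?_, ?_⟩ <;> field_simp <;> ring
end
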